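/- arXiv:1509.06394 — 2 statements merged into one kernel-verified Lean document; each statement's English description precedes it below -/
import Mathlib

section
/- Suppose Condition 3 holds for the LSIPP problem (P). Then the homogenized sum-of-squares relaxation values p̃^sos_k = inf{ c^T x : a^h(Ỹ)^T x + b^h(Ỹ) ∈ Q_k(G^h) } are nonincreasing in k, bounded below by p̃*, and converge to p̃* as k → ∞. Moreover, if S is closed at ∞ or Condition 2 holds for (P), then p̃^sos_k converges to p*. -/
open MvPolynomial

/-- A polynomial is a sum of squares. -/
def SOSPoly {n : ℕ} (p : MvPolynomial (Fin n) ℝ) : Prop :=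
  ∃ (t : ℕ) (q : Fin t → MvPolynomial (Fin n) ℝ), p = ∑ i, q i ^ 2

/-- Membership in the quadratic module Q(G) generated by `g`. -/
def QModMem {n s : ℕ} (g : Fin s → MvPolynomial (Fin n) ℝ)
    (p : MvPolynomial (Fin n) ℝ) : Prop :=
  ∃ (σ₀ : MvPolynomial (Fin n) ℝ) (σ : Fin s → MvPolynomial (Fin n) ℝ),
    SOSPoly σ₀ ∧ (∀ j, SOSPoly (σ j)) ∧ p = σ₀ + ∑ j, σ j * g j

/-- The basic semialgebraic index set S. -/
def indexSet {n s : ℕ} (g : Fin s → MvPolynomial (Fin n) ℝ) : Set (Fin n → ℝ) :=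
  {y | ∀ j, 0 ≤ eval y (g j)}

/-- Feasibility for the LSIPP problem (P): a(y)ᵀx + b(y) ≥ 0 for all y ∈ S. -/
def isFeasible {n m s : ℕ} (a : Fin m → MvPolynomial (Fin n) ℝ)
    (b : MvPolynomial (Fin n) ℝ) (g : Fin s → MvPolynomial (Fin n) ℝ)
    (x : Fin m → ℝ) : Prop :=
  ∀ y ∈ indexSet g, 0 ≤ (∑ i, x i * eval y (a i)) + eval y b

/-- Homogenization of `f` to degree `D` with respect to the new variable Y₀
(the variable of index 0; the original variables Y_i become the variables of
index i.succ). -/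
noncomputable def polyHomog {n : ℕ} (D : ℕ) (f : MvPolynomial (Fin n) ℝ) :
    MvPolynomial (Fin (n + 1)) ℝ :=
  ∑ α ∈ f.support,
    MvPolynomial.monomial
      (Finsupp.single (0 : Fin (n + 1)) (D - ∑ i, α i) + Finsupp.mapDomain Fin.succ α)
      (f.coeff α)

/-- The set S̃_> = {ỹ : g_j^h(ỹ) ≥ 0, y₀ > 0, ‖ỹ‖² = 1}. -/
def tildeSPos {n s : ℕ} (g : Fin s → MvPolynomial (Fin n) ℝ) :
    Set (Fin (n + 1) → ℝ) :=
  {y | (∀ j, 0 ≤ eval y (polyHomog (g j).totalDegree (g j))) ∧ 0 < y 0 ∧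
    ∑ i, y i ^ 2 = 1}

/-- The set S̃ = {ỹ : g_j^h(ỹ) ≥ 0, y₀ ≥ 0, ‖ỹ‖² = 1}. -/
def tildeS {n s : ℕ} (g : Fin s → MvPolynomial (Fin n) ℝ) :
    Set (Fin (n + 1) → ℝ) :=
  {y | (∀ j, 0 ≤ eval y (polyHomog (g j).totalDegree (g j))) ∧ 0 ≤ y 0 ∧
    ∑ i, y i ^ 2 = 1}

/-- The set Ŝ = {y : ĝ_j(y) ≥ 0, ‖y‖² = 1}, where ĝ_j(y) = g_j^h(0, y). -/
def hatS {n s : ℕ} (g : Fin s → MvPolynomial (Fin n) ℝ) : Set (Fin n → ℝ) :=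
  {y | (∀ j, 0 ≤ eval (Fin.cons 0 y) (polyHomog (g j).totalDegree (g j))) ∧
    ∑ i, y i ^ 2 = 1}

/-- ω = max{deg a₁, …, deg a_m, deg b}, the common homogenization degree. -/
def omegaDeg {n m : ℕ} (a : Fin m → MvPolynomial (Fin n) ℝ)
    (b : MvPolynomial (Fin n) ℝ) : ℕ :=
  max (Finset.univ.sup fun i => (a i).totalDegree) b.totalDegree

/-- The polynomial ‖Ỹ‖² = Y₀² + ⋯ + Y_n². -/
noncomputable def normSq (n : ℕ) : MvPolynomial (Fin (n + 1)) ℝ :=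
  ∑ i : Fin (n + 1), X i ^ 2

/-- Membership in the k-th truncated quadratic module Q_k(G^h) generated by
G^h = {g₁^h, …, g_s^h, Y₀, ‖Ỹ‖² − 1, 1 − ‖Ỹ‖²}. -/
def QModMemHK {n s : ℕ} (g : Fin s → MvPolynomial (Fin n) ℝ) (k : ℕ)
    (p : MvPolynomial (Fin (n + 1)) ℝ) : Prop :=
  ∃ (σ₀ : MvPolynomial (Fin (n + 1)) ℝ) (σ : Fin s → MvPolynomial (Fin (n + 1)) ℝ)
    (τ₀ τ₁ τ₂ : MvPolynomial (Fin (n + 1)) ℝ),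
    SOSPoly σ₀ ∧ (∀ j, SOSPoly (σ j)) ∧ SOSPoly τ₀ ∧ SOSPoly τ₁ ∧ SOSPoly τ₂ ∧
    σ₀.totalDegree ≤ 2 * k ∧
    (∀ j, (σ j * polyHomog (g j).totalDegree (g j)).totalDegree ≤ 2 * k) ∧
    (τ₀ * X 0).totalDegree ≤ 2 * k ∧
    (τ₁ * (normSq n - 1)).totalDegree ≤ 2 * k ∧
    (τ₂ * (1 - normSq n)).totalDegree ≤ 2 * k ∧
    p = σ₀ + (∑ j, σ j * polyHomog (g j).totalDegree (g j)) + τ₀ * X 0 +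
      τ₁ * (normSq n - 1) + τ₂ * (1 - normSq n)

/-- Feasibility for the homogenized LSIPP problem (8). -/
def isFeasibleH {n m s : ℕ} (a : Fin m → MvPolynomial (Fin n) ℝ)
    (b : MvPolynomial (Fin n) ℝ) (g : Fin s → MvPolynomial (Fin n) ℝ)
    (x : Fin m → ℝ) : Prop :=
  ∀ yt ∈ tildeS g,
    0 ≤ (∑ i, x i * eval yt (polyHomog (omegaDeg a b) (a i))) +
      eval yt (polyHomog (omegaDeg a b) b)

/-- The optimal value p̃* of the homogenized LSIPP problem (8), as an extended real. -/
noncomputable def ptilde {n m s : ℕ} (c : Fin m → ℝ)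
    (a : Fin m → MvPolynomial (Fin n) ℝ) (b : MvPolynomial (Fin n) ℝ)
    (g : Fin s → MvPolynomial (Fin n) ℝ) : EReal :=
  sInf ((fun x : Fin m → ℝ => ((∑ i, c i * x i : ℝ) : EReal)) ''
    {x | isFeasibleH a b g x})

/-- The k-th SOS relaxation value p̃^sos_k of the homogenized problem. -/
noncomputable def psosHK {n m s : ℕ} (c : Fin m → ℝ)
    (a : Fin m → MvPolynomial (Fin n) ℝ) (b : MvPolynomial (Fin n) ℝ)
    (g : Fin s → MvPolynomial (Fin n) ℝ) (k : ℕ) : EReal :=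
  sInf ((fun x : Fin m → ℝ => ((∑ i, c i * x i : ℝ) : EReal)) ''
    {x | QModMemHK g k
      ((∑ i, C (x i) * polyHomog (omegaDeg a b) (a i)) + polyHomog (omegaDeg a b) b)})

/-- Condition 2: for every ε > 0 there is a feasible point x of (P) with
c ᵀ x − p* ≤ ε and â(y)ᵀx + b̂(y) ≥ 0 on Ŝ. -/
def Condition2 {n m s : ℕ} (c : Fin m → ℝ) (a : Fin m → MvPolynomial (Fin n) ℝ)
    (b : MvPolynomial (Fin n) ℝ) (g : Fin s → MvPolynomial (Fin n) ℝ)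
    (pstar : ℝ) : Prop :=
  ∀ ε : ℝ, 0 < ε → ∃ x : Fin m → ℝ, isFeasible a b g x ∧
    (∑ i, c i * x i) - pstar ≤ ε ∧
    ∀ y ∈ hatS g,
      0 ≤ (∑ i, x i * eval (Fin.cons 0 y) (polyHomog (omegaDeg a b) (a i))) +
        eval (Fin.cons 0 y) (polyHomog (omegaDeg a b) b)

/-- Condition 3: there exists x̄ with a(y)ᵀx̄ + b(y) > 0 on S and
â(y)ᵀx̄ + b̂(y) > 0 on Ŝ. -/
def Condition3 {n m s : ℕ} (a : Fin m → MvPolynomial (Fin n) ℝ)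
    (b : MvPolynomial (Fin n) ℝ) (g : Fin s → MvPolynomial (Fin n) ℝ) : Prop :=
  ∃ x : Fin m → ℝ,
    (∀ y ∈ indexSet g, 0 < (∑ i, x i * eval y (a i)) + eval y b) ∧
    (∀ y ∈ hatS g,
      0 < (∑ i, x i * eval (Fin.cons 0 y) (polyHomog (omegaDeg a b) (a i))) +
        eval (Fin.cons 0 y) (polyHomog (omegaDeg a b) b))

section SphericalPositivstellensatz

variable {n : ℕ} {M : PointedCone ℝ (MvPolynomial (Fin n) ℝ)}

lemma mul_mem_of_mem_of_neg_mem (hsq : ∀ q, ∀ h ∈ M, q ^ 2 * h ∈ M)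
    {h : MvPolynomial (Fin n) ℝ} (hp : h ∈ M) (hn : -h ∈ M) (f : MvPolynomial (Fin n) ℝ) :
    f * h ∈ M := by
  have h1 := M.add_mem (hsq (C (1 / 2) * (f + 1)) h hp) (hsq (C (1 / 2) * (f - 1)) (-h) hn)
  have hC : (C (1 / 2) : MvPolynomial (Fin n) ℝ) ^ 2 * 4 = 1 := by
    rw [← C_pow, show (4 : MvPolynomial (Fin n) ℝ) = C 4 from rfl, ← C_mul]
    norm_num
  convert h1 using 1
  linear_combination (-f * h) * hC

lemma one_add_X_mul_mem (hsq : ∀ q, ∀ h ∈ M, q ^ 2 * h ∈ M)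
    (hs : 1 - ∑ i, X i ^ 2 ∈ M) (hs' : ∑ i, X i ^ 2 - 1 ∈ M) {e : ℝ} (he : e ^ 2 = 1)
    (i : Fin n) {h : MvPolynomial (Fin n) ℝ} (hh : h ∈ M) : (1 + C e * X i) * h ∈ M := by
  have h1 := hsq (C (1 / 2) * 2) _ (hsq (1 + C e * X i) h hh)
  have h2 : (∑ j ∈ Finset.univ.erase i, X j ^ 2 * h) ∈ M :=
    M.sum_mem fun j _ => hsq _ _ hh
  have h3 := mul_mem_of_mem_of_neg_mem hsq hs (by simpa using hs') h
  have h4 := M.smul_mem (show (0 : ℝ) ≤ 1 / 2 by norm_num)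
    (M.add_mem (M.add_mem (hsq (1 + C e * X i) h hh) h2) h3)
  rw [← Finset.add_sum_erase _ _ (Finset.mem_univ i), smul_eq_C_mul,
    ← Finset.sum_mul] at h4
  have hC : (C (1 / 2) : MvPolynomial (Fin n) ℝ) * 2 = 1 := by
    rw [show (2 : MvPolynomial (Fin n) ℝ) = C 2 from rfl, ← C_mul]
    norm_num
  have hE : (C e : MvPolynomial (Fin n) ℝ) ^ 2 = 1 := by rw [← C_pow, he, C_1]
  convert h4 using 1
  linear_combination (-(1 + C e * X i) * h) * hC - (C (1 / 2) * X i ^ 2 * h) * hE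

lemma exists_bound_mul_mem (hsq : ∀ q, ∀ h ∈ M, q ^ 2 * h ∈ M)
    (hs : 1 - ∑ i, X i ^ 2 ∈ M) (hs' : ∑ i, X i ^ 2 - 1 ∈ M) (f : MvPolynomial (Fin n) ℝ) :
    ∃ N : ℝ, ∀ h ∈ M, (C N + f) * h ∈ M ∧ (C N - f) * h ∈ M := by
  have hsm : ∀ r : ℝ, 0 ≤ r → ∀ h ∈ M, C r * h ∈ M := fun r hr h hh => by
    simpa [smul_eq_C_mul] using M.smul_mem hr hh
  have hX : ∀ (i : Fin n), ∀ h ∈ M, (C 1 + X i) * h ∈ M ∧ (C 1 - X i) * h ∈ M := by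
    intro i h hh
    constructor
    · simpa using one_add_X_mul_mem hsq hs hs' (e := 1) (by norm_num) i hh
    · simpa [sub_eq_add_neg] using one_add_X_mul_mem hsq hs hs' (e := -1) (by norm_num) i hh
  have hC : (C (1 / 2) : MvPolynomial (Fin n) ℝ) * 2 = 1 := by
    rw [show (2 : MvPolynomial (Fin n) ℝ) = C 2 from rfl, ← C_mul]
    norm_num
  induction f using MvPolynomial.induction_on with
  | C r =>
    refine ⟨|r|, fun h hh => ?_⟩
    rw [← C_add, ← C_sub]
    exact ⟨hsm _ (by linarith [neg_abs_le r]) h hh, hsm _ (by linarith [le_abs_self r]) h hh⟩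
  | add p q hp hq =>
    obtain ⟨N, hN⟩ := hp
    obtain ⟨K, hK⟩ := hq
    refine ⟨N + K, fun h hh => ⟨?_, ?_⟩⟩
    · convert M.add_mem (hN h hh).1 (hK h hh).1 using 1
      rw [C_add]; ring
    · convert M.add_mem (hN h hh).2 (hK h hh).2 using 1
      rw [C_add]; ring
  | mul_X p i hp =>
    obtain ⟨N, hN⟩ := hp
    refine ⟨N, fun h hh => ⟨?_, ?_⟩⟩
    · convert hsm (1 / 2) (by norm_num) _ (M.add_mem (hN _ (hX i h hh).1).1
        (hN _ (hX i h hh).2).2) using 1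
      rw [C_1]
      linear_combination (-(C N + p * X i) * h) * hC
    · convert hsm (1 / 2) (by norm_num) _ (M.add_mem (hN _ (hX i h hh).1).2
        (hN _ (hX i h hh).2).1) using 1
      rw [C_1]
      linear_combination (-(C N - p * X i) * h) * hC

/-- The normalized linear functionals that are nonnegative on the cone `M`, as a subset of the
product space of all real functions on the polynomial ring. -/
def stateSet (M : PointedCone ℝ (MvPolynomial (Fin n) ℝ)) :
    Set (MvPolynomial (Fin n) ℝ → ℝ) :=
  {L | (∀ f g, L (f + g) = L f + L g) ∧ (∀ (c : ℝ) f, L (C c * f) = c * L f) ∧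
    (∀ f ∈ M, 0 ≤ L f) ∧ L 1 = 1}

lemma isCompact_stateSet
    (hb : ∀ f, ∃ N : ℝ, C N + f ∈ M ∧ C N - f ∈ M) : IsCompact (stateSet M) := by
  choose N hN using hb
  refine (isCompact_univ_pi fun f => isCompact_Icc (a := -N f) (b := N f)).of_isClosed_subset
    ?_ ?_
  · simp only [stateSet, Set.ofPred_and, Set.ofPred_forall]
    refine IsClosed.inter ?_ (IsClosed.inter ?_ (IsClosed.inter ?_ ?_))
    · exact isClosed_iInter fun f => isClosed_iInter fun g =>
        isClosed_eq (by fun_prop) (by fun_prop)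
    · exact isClosed_iInter fun f => isClosed_iInter fun g =>
        isClosed_eq (by fun_prop) (by fun_prop)
    · exact isClosed_iInter fun f => isClosed_iInter fun _ =>
        isClosed_le (by fun_prop) (by fun_prop)
    · exact isClosed_eq (by fun_prop) (by fun_prop)
  · rintro L ⟨hadd, hmul, hpos, hone⟩ f -
    have hc : ∀ c : ℝ, L (C c) = c := fun c => by simpa [hone] using hmul c 1
    have hneg : L (-f) = - L f := by simpa using hmul (-1) f
    have h1 := hpos _ (hN f).1
    have h2 := hpos _ (hN f).2
    rw [hadd, hc] at h1
    rw [sub_eq_add_neg, hadd, hc, hneg] at h2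
    exact ⟨by linarith, by linarith⟩

lemma eq_mul_of_mem_extremePoints (hsq : ∀ q, ∀ h ∈ M, q ^ 2 * h ∈ M) (h1 : 1 ∈ M)
    (hs : 1 - ∑ i, X i ^ 2 ∈ M) (hs' : ∑ i, X i ^ 2 - 1 ∈ M)
    {L : MvPolynomial (Fin n) ℝ → ℝ} (hL : L ∈ Set.extremePoints ℝ (stateSet M))
    (i : Fin n) (f : MvPolynomial (Fin n) ℝ) : L (X i * f) = L (X i) * L f := by
  rw [mem_extremePoints] at hL
  obtain ⟨⟨hadd, hmul, hpos, hone⟩, hext⟩ := hL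
  have hc : ∀ c : ℝ, L (C c) = c := fun c => by simpa [hone] using hmul c 1
  have hneg : ∀ f, L (-f) = - L f := fun f => by simpa using hmul (-1) f
  have hadj : ∀ e : ℝ, ∀ f, L ((1 + C e * X i) * f) = L f + e * L (X i * f) := fun e f => by
    rw [add_mul, hadd, mul_assoc, hmul, one_mul]
  have hadj_pos : ∀ e : ℝ, e ^ 2 = 1 → ∀ f ∈ M, 0 ≤ L f + e * L (X i * f) := fun e he f hf => by
    rw [← hadj]
    exact hpos _ (one_add_X_mul_mem hsq hs hs' he i hf)
  have hdegen : ∀ e : ℝ, e ^ 2 = 1 → 1 + e * L (X i) = 0 → L f + e * L (X i * f) = 0 := by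
    intro e he h0
    obtain ⟨N, hN⟩ := exists_bound_mul_mem hsq hs hs' f
    have hN1 := hadj_pos e he _ (hN 1 h1).1
    have hN2 := hadj_pos e he _ (hN 1 h1).2
    rw [mul_one, hadd, hc, mul_add, hadd, mul_comm (X i) (C N), hmul] at hN1
    rw [mul_one, sub_eq_add_neg, hadd, hc, mul_add, hadd, mul_comm (X i) (C N), hmul,
      mul_neg, hneg, hneg] at hN2
    have hz : N + N * (e * L (X i)) = 0 := by linear_combination N * h0
    nlinarith
  have hstate : ∀ e : ℝ, e ^ 2 = 1 → 0 < 1 + e * L (X i) →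
      (fun f => (1 + e * L (X i))⁻¹ * (L f + e * L (X i * f))) ∈ stateSet M := by
    intro e he h0
    refine ⟨fun f g => ?_, fun c f => ?_, fun f hf => ?_, ?_⟩
    · simp only [mul_add, hadd]; ring
    · simp only [hmul, mul_left_comm (X i) (C c)]; ring
    · exact mul_nonneg (inv_nonneg.2 h0.le) (hadj_pos e he f hf)
    · simp only [mul_one, hone]
      exact inv_mul_cancel₀ h0.ne'
  have hp := hadj_pos 1 (by norm_num) 1 h1
  have hm := hadj_pos (-1) (by norm_num) 1 h1
  rw [mul_one, hone] at hp hm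
  rcases hp.eq_or_lt with hp | hp
  · have h2 := hdegen 1 (by norm_num) hp.symm
    linear_combination h2 + hp * L f
  rcases hm.eq_or_lt with hm | hm
  · have h2 := hdegen (-1) (by norm_num) hm.symm
    linear_combination -h2 - hm * L f
  have key := (hext _ (hstate 1 (by norm_num) hp) _ (hstate (-1) (by norm_num) hm)
    ⟨(1 + 1 * L (X i)) / 2, (1 + (-1) * L (X i)) / 2, by linarith, by linarith, by ring, ?_⟩).1
  · have h2 := congrFun key f
    rw [inv_mul_eq_iff_eq_mul₀ hp.ne'] at h2
    linear_combination h2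
  · funext f
    simp only [Pi.add_apply, Pi.smul_apply, smul_eq_mul]
    linear_combination (L f + 1 * L (X i * f)) / 2 * mul_inv_cancel₀ hp.ne' +
      (L f + -1 * L (X i * f)) / 2 * mul_inv_cancel₀ hm.ne'

/-- Putinar's Positivstellensatz for a quadratic module containing `±(‖X‖² - 1)`. -/
theorem mem_of_pos_of_sphere_mem (hsq : ∀ q, ∀ h ∈ M, q ^ 2 * h ∈ M) (h1 : 1 ∈ M)
    (hs : 1 - ∑ i, X i ^ 2 ∈ M) (hs' : ∑ i, X i ^ 2 - 1 ∈ M) {p : MvPolynomial (Fin n) ℝ}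
    (hp : ∀ x : Fin n → ℝ, (∀ f ∈ M, 0 ≤ eval x f) → 0 < eval x p) : p ∈ M := by
  by_contra hpM
  have hb : ∀ f, ∃ N : ℝ, C N + f ∈ M ∧ C N - f ∈ M := fun f => by
    obtain ⟨N, hN⟩ := exists_bound_mul_mem hsq hs hs' f
    exact ⟨N, by simpa using hN 1 h1⟩
  have hsm : ∀ r : ℝ, 0 ≤ r → ∀ h ∈ M, r • h ∈ M := fun r hr h hh =>
    M.smul_mem hr hh
  have hne : ∃ L ∈ stateSet M, L p ≤ 0 := by
    let φ : MvPolynomial (Fin n) ℝ →ₗ.[ℝ] ℝ :=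
      LinearPMap.mkSpanSingleton (1 : MvPolynomial (Fin n) ℝ) (1 : ℝ) one_ne_zero
    have hnonneg : ∀ x : φ.domain,
        (x : MvPolynomial (Fin n) ℝ) ∈ M ⊔ PointedCone.hull ℝ {-p} → 0 ≤ φ x := by
      rintro ⟨x, hx⟩ hxM
      obtain ⟨r, rfl⟩ := Submodule.mem_span_singleton.1 hx
      rw [LinearPMap.mkSpanSingleton'_apply]
      simp only [smul_eq_mul, mul_one, RingHom.id_apply]
      by_contra! hr
      obtain ⟨m, hm, q, hq, hmq⟩ := Submodule.mem_sup.1 hxM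
      obtain ⟨t, rfl⟩ := Submodule.mem_span_singleton.1 hq
      obtain ⟨t, ht⟩ := t
      simp only [Nonneg.mk_smul] at hmq
      rcases ht.eq_or_lt with rfl | ht
      · obtain ⟨N, hN⟩ := hb p
        rw [zero_smul, add_zero] at hmq
        apply hpM
        have h3 := M.add_mem hN.1 (hsm (|N| / (-r)) (div_nonneg (abs_nonneg _) (by linarith)) _ hm)
        have h4 := M.add_mem h3 (hsm (|N| - N) (by linarith [le_abs_self N]) _ h1)
        convert h4 using 1
        rw [hmq, smul_smul, smul_eq_C_mul, smul_eq_C_mul, mul_one, mul_one,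
          show |N| / -r * r = -|N| by field_simp [hr.ne], C_sub, C_neg]
        ring
      · apply hpM
        have h3 := hsm t⁻¹ (inv_nonneg.2 ht.le) _ (M.add_mem hm (hsm (-r) (by linarith) 1 h1))
        convert h3 using 1
        rw [eq_inv_smul_iff₀ ht.ne', neg_smul, ← hmq]
        simp
    have hdense : ∀ y : MvPolynomial (Fin n) ℝ, ∃ x : φ.domain,
        (x : MvPolynomial (Fin n) ℝ) + y ∈ M ⊔ PointedCone.hull ℝ {-p} := by
      intro y
      obtain ⟨N, hN⟩ := hb y
      refine ⟨⟨N • 1, Submodule.smul_mem _ _ (Submodule.mem_span_singleton_self 1)⟩, ?_⟩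
      refine Submodule.mem_sup_left ?_
      simpa [smul_eq_C_mul] using hN.1
    obtain ⟨L, hL1, hL2⟩ := riesz_extension (M ⊔ PointedCone.hull ℝ {-p})
      φ hnonneg hdense
    refine ⟨L, ⟨map_add L, fun c f => ?_, fun f hf => ?_, ?_⟩, ?_⟩
    · rw [← smul_eq_C_mul, map_smul, smul_eq_mul]
    · exact hL2 f (Submodule.mem_sup_left hf)
    · have := hL1 ⟨1, Submodule.mem_span_singleton_self 1⟩
      rwa [LinearPMap.mkSpanSingleton_apply] at this
    · have := hL2 (-p) (Submodule.mem_sup_right (Submodule.mem_span_singleton_self _))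
      rw [map_neg] at this
      linarith
  obtain ⟨L₀, hL₀, hL₀p⟩ := hne
  have hcomp := isCompact_stateSet hb
  obtain ⟨L₁, hL₁, hmin⟩ := hcomp.exists_isMinOn ⟨L₀, hL₀⟩
    (f := fun L : MvPolynomial (Fin n) ℝ → ℝ => L p) (by fun_prop)
  have hexp : IsExposed ℝ (stateSet M) {L ∈ stateSet M | ∀ L' ∈ stateSet M, L p ≤ L' p} :=
    fun _ => ⟨-ContinuousLinearMap.proj p, by ext; simp⟩
  obtain ⟨L, hL⟩ := (hexp.isCompact hcomp).extremePoints_nonempty ⟨L₁, hL₁, fun L' h => hmin h⟩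
  have hLp : L p ≤ 0 := (hL.1.2 _ hL₀).trans hL₀p
  have hLe := hexp.isExtreme.extremePoints_subset_extremePoints hL
  have hLX := eq_mul_of_mem_extremePoints hsq h1 hs hs' hLe
  obtain ⟨⟨hadd, hmul, hpos, hone⟩, -⟩ := hLe
  have heval : ∀ f, L f = eval (fun i => L (X i)) f := fun f => by
    induction f using MvPolynomial.induction_on with
    | C r => simpa [hone] using hmul r 1
    | add p q hp hq => rw [hadd, hp, hq, map_add]
    | mul_X p i hp => rw [mul_comm, hLX, hp, map_mul, eval_X]
  have := hp (fun i => L (X i)) fun f hf => (heval f) ▸ hpos f hf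
  rw [← heval] at this
  linarith

end SphericalPositivstellensatz

section HomogenizedModule

lemma SOSPoly.zero {n : ℕ} : SOSPoly (0 : MvPolynomial (Fin n) ℝ) := ⟨0, 0, by simp⟩

lemma SOSPoly.one {n : ℕ} : SOSPoly (1 : MvPolynomial (Fin n) ℝ) := ⟨1, 1, by simp⟩

lemma SOSPoly.add {n : ℕ} {p q : MvPolynomial (Fin n) ℝ} (hp : SOSPoly p) (hq : SOSPoly q) :
    SOSPoly (p + q) := by
  obtain ⟨t, u, rfl⟩ := hp
  obtain ⟨t', u', rfl⟩ := hq
  exact ⟨t + t', Fin.append u u', by simp [Fin.sum_univ_add]⟩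

lemma SOSPoly.sq_mul {n : ℕ} {p : MvPolynomial (Fin n) ℝ} (q : MvPolynomial (Fin n) ℝ)
    (hp : SOSPoly p) : SOSPoly (q ^ 2 * p) := by
  obtain ⟨t, u, rfl⟩ := hp
  exact ⟨t, fun i => q * u i, by simp [Finset.mul_sum, mul_pow]⟩

lemma SOSPoly.eval_nonneg {n : ℕ} {p : MvPolynomial (Fin n) ℝ} (hp : SOSPoly p)
    (y : Fin n → ℝ) : 0 ≤ eval y p := by
  obtain ⟨t, u, rfl⟩ := hp
  rw [map_sum]
  exact Finset.sum_nonneg fun i _ => by rw [map_pow]; positivity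

variable {n s : ℕ} {g : Fin s → MvPolynomial (Fin n) ℝ} {k l : ℕ}
  {p q : MvPolynomial (Fin (n + 1)) ℝ}

lemma QModMemHK.mono (hkl : k ≤ l) (h : QModMemHK g k p) : QModMemHK g l p := by
  obtain ⟨σ₀, σ, τ₀, τ₁, τ₂, h0, h1, h2, h3, h4, d0, d1, d2, d3, d4, rfl⟩ := h
  have hkl' : 2 * k ≤ 2 * l := by omega
  exact ⟨σ₀, σ, τ₀, τ₁, τ₂, h0, h1, h2, h3, h4, d0.trans hkl', fun j => (d1 j).trans hkl',
    d2.trans hkl', d3.trans hkl', d4.trans hkl', rfl⟩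

lemma QModMemHK.add (hp : QModMemHK g k p) (hq : QModMemHK g k q) : QModMemHK g k (p + q) := by
  obtain ⟨σ₀, σ, τ₀, τ₁, τ₂, h0, h1, h2, h3, h4, d0, d1, d2, d3, d4, rfl⟩ := hp
  obtain ⟨σ₀', σ', τ₀', τ₁', τ₂', h0', h1', h2', h3', h4', d0', d1', d2', d3', d4', rfl⟩ := hq
  have hadd : ∀ {u v : MvPolynomial (Fin (n + 1)) ℝ}, u.totalDegree ≤ 2 * k →
      v.totalDegree ≤ 2 * k → (u + v).totalDegree ≤ 2 * k := fun hu hv =>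
    (totalDegree_add _ _).trans (max_le hu hv)
  refine ⟨σ₀ + σ₀', σ + σ', τ₀ + τ₀', τ₁ + τ₁', τ₂ + τ₂', h0.add h0', fun j => (h1 j).add (h1' j),
    h2.add h2', h3.add h3', h4.add h4', hadd d0 d0', fun j => ?_, ?_, ?_, ?_, ?_⟩
  · rw [Pi.add_apply, add_mul]; exact hadd (d1 j) (d1' j)
  · rw [add_mul]; exact hadd d2 d2'
  · rw [add_mul]; exact hadd d3 d3'
  · rw [add_mul]; exact hadd d4 d4'
  · simp only [Pi.add_apply, add_mul, Finset.sum_add_distrib]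
    ring

lemma QModMemHK.sq_mul (q : MvPolynomial (Fin (n + 1)) ℝ) (hp : QModMemHK g k p) :
    QModMemHK g (q.totalDegree + k) (q ^ 2 * p) := by
  obtain ⟨σ₀, σ, τ₀, τ₁, τ₂, h0, h1, h2, h3, h4, d0, d1, d2, d3, d4, rfl⟩ := hp
  have hmul : ∀ {u : MvPolynomial (Fin (n + 1)) ℝ}, u.totalDegree ≤ 2 * k →
      (q ^ 2 * u).totalDegree ≤ 2 * (q.totalDegree + k) := fun {u} hu => by
    have e1 := totalDegree_mul (q ^ 2) u
    have e2 := totalDegree_pow q 2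
    omega
  refine ⟨q ^ 2 * σ₀, fun j => q ^ 2 * σ j, q ^ 2 * τ₀, q ^ 2 * τ₁, q ^ 2 * τ₂, h0.sq_mul q,
    fun j => (h1 j).sq_mul q, h2.sq_mul q, h3.sq_mul q, h4.sq_mul q, hmul d0, fun j => ?_,
    ?_, ?_, ?_, ?_⟩
  · rw [mul_assoc]; exact hmul (d1 j)
  · rw [mul_assoc]; exact hmul d2
  · rw [mul_assoc]; exact hmul d3
  · rw [mul_assoc]; exact hmul d4
  · simp only [mul_assoc, ← Finset.mul_sum]
    ring

/-- The quadratic module generated by `G^h`, without degree bounds, as a pointed cone. -/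
def homogModule (g : Fin s → MvPolynomial (Fin n) ℝ) :
    PointedCone ℝ (MvPolynomial (Fin (n + 1)) ℝ) where
  carrier := {p | ∃ k, QModMemHK g k p}
  zero_mem' := ⟨0, 0, 0, 0, 0, 0, SOSPoly.zero, fun _ => SOSPoly.zero, SOSPoly.zero, SOSPoly.zero,
    SOSPoly.zero, by simp⟩
  add_mem' := by
    rintro p q ⟨k, hp⟩ ⟨l, hq⟩
    exact ⟨max k l, (hp.mono (le_max_left _ _)).add (hq.mono (le_max_right _ _))⟩
  smul_mem' := by
    rintro ⟨r, hr⟩ p ⟨k, hp⟩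
    have h := hp.sq_mul (C √r)
    rw [← C_pow, Real.sq_sqrt hr, ← smul_eq_C_mul] at h
    exact ⟨_, h⟩

lemma mem_homogModule : p ∈ homogModule g ↔ ∃ k, QModMemHK g k p := Iff.rfl

lemma sq_mul_mem_homogModule (q : MvPolynomial (Fin (n + 1)) ℝ) (hp : p ∈ homogModule g) :
    q ^ 2 * p ∈ homogModule g := by
  obtain ⟨k, hk⟩ := hp
  exact ⟨_, hk.sq_mul q⟩

lemma one_mem_homogModule : 1 ∈ homogModule g :=
  ⟨0, 1, 0, 0, 0, 0, SOSPoly.one, fun _ => SOSPoly.zero, SOSPoly.zero, SOSPoly.zero,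
    SOSPoly.zero, by simp⟩

lemma polyHomog_mem_homogModule (j : Fin s) :
    polyHomog (g j).totalDegree (g j) ∈ homogModule g := by
  classical
  refine ⟨(polyHomog (g j).totalDegree (g j)).totalDegree, 0, Pi.single j 1, 0, 0, 0,
    SOSPoly.zero, fun i => ?_, SOSPoly.zero, SOSPoly.zero, SOSPoly.zero, by simp, fun i => ?_,
    by simp, by simp, by simp, ?_⟩
  · rcases eq_or_ne i j with rfl | h
    · simpa using SOSPoly.one
    · simpa [h] using SOSPoly.zero
  · rcases eq_or_ne i j with rfl | h
    · rw [Pi.single_eq_same, one_mul]; omega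
    · simp [h]
  · rw [Finset.sum_eq_single j (fun i _ h => by simp [h]) (by simp)]
    simp

lemma X_zero_mem_homogModule : X 0 ∈ homogModule g := by
  refine ⟨(X 0 : MvPolynomial (Fin (n + 1)) ℝ).totalDegree, 0, 0, 1, 0, 0, SOSPoly.zero,
    fun _ => SOSPoly.zero, SOSPoly.one, SOSPoly.zero, SOSPoly.zero, by simp, by simp, ?_,
    by simp, by simp, by simp⟩
  rw [one_mul]; omega

lemma normSq_sub_one_mem_homogModule : normSq n - 1 ∈ homogModule g := by
  refine ⟨(normSq n - 1).totalDegree, 0, 0, 0, 1, 0, SOSPoly.zero,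
    fun _ => SOSPoly.zero, SOSPoly.zero, SOSPoly.one, SOSPoly.zero, by simp, by simp, by simp,
    ?_, by simp, by simp⟩
  rw [one_mul]; omega

lemma one_sub_normSq_mem_homogModule : 1 - normSq n ∈ homogModule g := by
  refine ⟨(1 - normSq n).totalDegree, 0, 0, 0, 0, 1, SOSPoly.zero,
    fun _ => SOSPoly.zero, SOSPoly.zero, SOSPoly.zero, SOSPoly.one, by simp, by simp, by simp,
    by simp, ?_, by simp⟩
  rw [one_mul]; omega

lemma QModMemHK.eval_nonneg (hp : QModMemHK g k p) {y : Fin (n + 1) → ℝ} (hy : y ∈ tildeS g) :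
    0 ≤ eval y p := by
  obtain ⟨σ₀, σ, τ₀, τ₁, τ₂, h0, h1, h2, h3, h4, -, -, -, -, -, rfl⟩ := hp
  obtain ⟨hg, hy0, hy1⟩ := hy
  have hN : eval y (normSq n) = 1 := by simp [normSq, hy1]
  have hsum : 0 ≤ ∑ j, eval y (σ j) * eval y (polyHomog (g j).totalDegree (g j)) :=
    Finset.sum_nonneg fun j _ => mul_nonneg ((h1 j).eval_nonneg y) (hg j)
  have := mul_nonneg (h2.eval_nonneg y) hy0
  have := h0.eval_nonneg y
  simp only [map_add, map_sum, map_mul, map_sub, map_one, hN, sub_self, mul_zero, eval_X]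
  linarith

lemma exists_QModMemHK_of_pos (hp : ∀ y ∈ tildeS g, 0 < eval y p) : ∃ k, QModMemHK g k p := by
  refine mem_homogModule.1 (mem_of_pos_of_sphere_mem (fun q h hh => sq_mul_mem_homogModule q hh)
    one_mem_homogModule one_sub_normSq_mem_homogModule normSq_sub_one_mem_homogModule
    fun y hy => hp y ⟨fun j => hy _ (polyHomog_mem_homogModule j), ?_, ?_⟩)
  · simpa using hy _ X_zero_mem_homogModule
  · have h1 := hy _ one_sub_normSq_mem_homogModule
    have h2 := hy _ normSq_sub_one_mem_homogModule
    simp only [normSq, map_sub, map_one, map_sum, map_pow, eval_X] at h1 h2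
    linarith

end HomogenizedModule

section Homogenization

variable {n : ℕ}

lemma eval_polyHomog {D : ℕ} {f : MvPolynomial (Fin n) ℝ} (hD : f.totalDegree ≤ D)
    {y : Fin (n + 1) → ℝ} (hy : y 0 ≠ 0) :
    eval y (polyHomog D f) = y 0 ^ D * eval (fun i => y i.succ / y 0) f := by
  rw [polyHomog, map_sum, eval_eq', Finset.mul_sum]
  refine Finset.sum_congr rfl fun α hα => ?_
  have hdeg : ∑ i, α i ≤ D := by
    have h := (le_totalDegree hα).trans hD
    rwa [Finsupp.sum_fintype _ _ fun _ => rfl] at h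
  rw [eval_monomial, Finsupp.prod_add_index' (by simp) (by simp [pow_add]),
    Finsupp.prod_single_index (by simp), Finsupp.prod_mapDomain_index_inj (Fin.succ_injective n),
    Finsupp.prod_fintype _ _ (by simp)]
  simp only [div_pow, Finset.prod_div_distrib, Finset.prod_pow_eq_pow_sum]
  have hpow : y 0 ^ D = y 0 ^ (D - ∑ i, α i) * y 0 ^ ∑ i, α i := by
    rw [← pow_add, Nat.sub_add_cancel hdeg]
  rw [hpow]
  field_simp

/-- The constraint function of the homogenized problem, as a polynomial. -/
noncomputable def homogConstraint {m : ℕ} (a : Fin m → MvPolynomial (Fin n) ℝ)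
    (b : MvPolynomial (Fin n) ℝ) (x : Fin m → ℝ) : MvPolynomial (Fin (n + 1)) ℝ :=
  (∑ i, C (x i) * polyHomog (omegaDeg a b) (a i)) + polyHomog (omegaDeg a b) b

variable {m s : ℕ} {a : Fin m → MvPolynomial (Fin n) ℝ} {b : MvPolynomial (Fin n) ℝ}
  {g : Fin s → MvPolynomial (Fin n) ℝ} {x : Fin m → ℝ}

lemma eval_homogConstraint (y : Fin (n + 1) → ℝ) : eval y (homogConstraint a b x) =
    (∑ i, x i * eval y (polyHomog (omegaDeg a b) (a i))) +
      eval y (polyHomog (omegaDeg a b) b) := by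
  simp [homogConstraint]

lemma eval_homogConstraint_of_ne_zero {y : Fin (n + 1) → ℝ} (hy : y 0 ≠ 0) :
    eval y (homogConstraint a b x) = y 0 ^ omegaDeg a b *
      ((∑ i, x i * eval (fun i => y i.succ / y 0) (a i)) +
        eval (fun i => y i.succ / y 0) b) := by
  have ha : ∀ i, (a i).totalDegree ≤ omegaDeg a b := fun i =>
    (Finset.le_sup (f := fun i => (a i).totalDegree) (Finset.mem_univ i)).trans (le_max_left _ _)
  have hb : b.totalDegree ≤ omegaDeg a b := le_max_right _ _
  rw [eval_homogConstraint, eval_polyHomog hb hy, mul_add, Finset.mul_sum]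
  simp only [eval_polyHomog (ha _) hy, mul_left_comm]

lemma div_mem_indexSet {y : Fin (n + 1) → ℝ} (hy : y ∈ tildeS g) (hy0 : 0 < y 0) :
    (fun i => y i.succ / y 0) ∈ indexSet g := fun j => by
  have h := hy.1 j
  rw [eval_polyHomog le_rfl hy0.ne'] at h
  exact nonneg_of_mul_nonneg_right h (by positivity)

lemma mem_hatS_or_pos {y : Fin (n + 1) → ℝ} (hy : y ∈ tildeS g) :
    (∃ z ∈ hatS g, y = Fin.cons 0 z) ∨ 0 < y 0 := by
  rcases hy.2.1.eq_or_lt with h0 | h0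
  · refine .inl ⟨Fin.tail y, ⟨fun j => ?_, ?_⟩, ?_⟩
    · have := hy.1 j
      rwa [← Fin.cons_self_tail y, ← h0] at this
    · have := hy.2.2
      rw [Fin.sum_univ_succ, ← h0] at this
      simpa [Fin.tail] using this
    · rw [h0, Fin.cons_self_tail]
  · exact .inr h0

lemma exists_mem_tildeSPos {z : Fin n → ℝ} (hz : z ∈ indexSet g) :
    ∃ y ∈ tildeSPos g, (fun i => y i.succ / y 0) = z := by
  have hpos : 0 < 1 + ∑ i, z i ^ 2 :=
    add_pos_of_pos_of_nonneg one_pos (Finset.sum_nonneg fun i _ => sq_nonneg _)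
  have hr : 0 < √(1 + ∑ i, z i ^ 2) := Real.sqrt_pos.2 hpos
  have hdiv : ∀ i, z i / √(1 + ∑ i, z i ^ 2) / (1 / √(1 + ∑ i, z i ^ 2)) = z i := fun i => by
    field_simp
  refine ⟨Fin.cons (1 / √(1 + ∑ i, z i ^ 2)) fun i => z i / √(1 + ∑ i, z i ^ 2),
    ⟨fun j => ?_, ?_, ?_⟩, ?_⟩
  · rw [eval_polyHomog le_rfl (by simpa using hr.ne')]
    simp only [Fin.cons_zero, Fin.cons_succ, hdiv]
    exact mul_nonneg (by positivity) (hz j)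
  · simpa using hr
  · rw [Fin.sum_univ_succ]
    simp only [Fin.cons_zero, Fin.cons_succ, div_pow, ← Finset.sum_div, Real.sq_sqrt hpos.le]
    rw [one_pow, ← add_div, div_self hpos.ne']
  · simp only [Fin.cons_zero, Fin.cons_succ, hdiv]

lemma tildeSPos_subset_tildeS : tildeSPos g ⊆ tildeS g := fun _ hy => ⟨hy.1, hy.2.1.le, hy.2.2⟩

lemma isFeasibleH_iff :
    isFeasibleH a b g x ↔ ∀ y ∈ tildeS g, 0 ≤ eval y (homogConstraint a b x) := by
  simp only [isFeasibleH, eval_homogConstraint]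

lemma isFeasible.eval_homogConstraint_nonneg (hx : isFeasible a b g x) {y : Fin (n + 1) → ℝ}
    (hy : y ∈ tildeS g) (hy0 : 0 < y 0) : 0 ≤ eval y (homogConstraint a b x) := by
  rw [eval_homogConstraint_of_ne_zero hy0.ne']
  exact mul_nonneg (by positivity) (hx _ (div_mem_indexSet hy hy0))

lemma isFeasibleH.isFeasible (hx : isFeasibleH a b g x) : isFeasible a b g x := by
  intro z hz
  obtain ⟨y, hy, rfl⟩ := exists_mem_tildeSPos hz
  have h := isFeasibleH_iff.1 hx y (tildeSPos_subset_tildeS hy)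
  rw [eval_homogConstraint_of_ne_zero hy.2.1.ne'] at h
  exact nonneg_of_mul_nonneg_right h (pow_pos hy.2.1 _)

lemma isFeasible.isFeasibleH_of_closure_eq (hS : closure (tildeSPos g) = tildeS g)
    (hx : isFeasible a b g x) : isFeasibleH a b g x := by
  rw [isFeasibleH_iff, ← hS]
  refine fun y hy => closure_minimal
    (s := tildeSPos g) (t := {y | 0 ≤ eval y (homogConstraint a b x)}) (fun y hy => ?_)
    (isClosed_le continuous_const (MvPolynomial.continuous_eval _)) hy
  exact hx.eval_homogConstraint_nonneg (tildeSPos_subset_tildeS hy) hy.2.1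

lemma isFeasible.isFeasibleH_of_hatS (hx : isFeasible a b g x)
    (hhat : ∀ y ∈ hatS g,
      0 ≤ (∑ i, x i * eval (Fin.cons 0 y) (polyHomog (omegaDeg a b) (a i))) +
        eval (Fin.cons 0 y) (polyHomog (omegaDeg a b) b)) : isFeasibleH a b g x := by
  rw [isFeasibleH_iff]
  intro y hy
  rcases mem_hatS_or_pos hy with ⟨z, hz, rfl⟩ | hy0
  · rw [eval_homogConstraint]
    exact hhat z hz
  · exact hx.eval_homogConstraint_nonneg hy hy0

lemma Condition3.exists_pos (h : Condition3 a b g) :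
    ∃ x : Fin m → ℝ, ∀ y ∈ tildeS g, 0 < eval y (homogConstraint a b x) := by
  obtain ⟨x, hx, hhat⟩ := h
  refine ⟨x, fun y hy => ?_⟩
  rcases mem_hatS_or_pos hy with ⟨z, hz, rfl⟩ | hy0
  · rw [eval_homogConstraint]
    exact hhat z hz
  · rw [eval_homogConstraint_of_ne_zero hy0.ne']
    exact mul_pos (by positivity) (hx _ (div_mem_indexSet hy hy0))

lemma eval_homogConstraint_convexCombination (t : ℝ) (x x' : Fin m → ℝ) (y : Fin (n + 1) → ℝ) :
    eval y (homogConstraint a b fun i => (1 - t) * x i + t * x' i) =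
      (1 - t) * eval y (homogConstraint a b x) + t * eval y (homogConstraint a b x') := by
  simp only [eval_homogConstraint, add_mul, Finset.sum_add_distrib, mul_assoc, ← Finset.mul_sum]
  ring

end Homogenization

section Values

variable {n m s : ℕ} {c : Fin m → ℝ} {a : Fin m → MvPolynomial (Fin n) ℝ}
  {b : MvPolynomial (Fin n) ℝ} {g : Fin s → MvPolynomial (Fin n) ℝ}

lemma antitone_psosHK : Antitone (psosHK c a b g) := fun _ _ hkl =>
  sInf_le_sInf (Set.image_mono fun _ hx => QModMemHK.mono hkl hx)

lemma ptilde_le_psosHK (k : ℕ) : ptilde c a b g ≤ psosHK c a b g k :=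
  sInf_le_sInf (Set.image_mono fun _ hx =>
    isFeasibleH_iff.2 fun _ hy => QModMemHK.eval_nonneg hx hy)

lemma ptilde_le {x : Fin m → ℝ} (hx : isFeasibleH a b g x) :
    ptilde c a b g ≤ ((∑ i, c i * x i : ℝ) : EReal) :=
  sInf_le ⟨x, hx, rfl⟩

lemma iInf_psosHK_le_ptilde (h : Condition3 a b g) :
    ⨅ k, psosHK c a b g k ≤ ptilde c a b g := by
  obtain ⟨x', hx'⟩ := h.exists_pos
  refine le_sInf ?_
  rintro _ ⟨x, hx, rfl⟩
  have hlim : Filter.Tendsto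
      (fun t : ℝ => ((∑ i, c i * ((1 - t) * x i + t * x' i) : ℝ) : EReal))
      (nhdsWithin 0 (Set.Ioi 0)) (nhds ((∑ i, c i * x i : ℝ) : EReal)) := by
    refine tendsto_nhdsWithin_of_tendsto_nhds ?_
    have hcont : Continuous fun t : ℝ =>
        ((∑ i, c i * ((1 - t) * x i + t * x' i) : ℝ) : EReal) :=
      continuous_coe_real_ereal.comp (by fun_prop)
    simpa using hcont.tendsto 0
  refine ge_of_tendsto hlim ?_
  filter_upwards [Ioo_mem_nhdsGT (zero_lt_one' ℝ)] with t ht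
  obtain ⟨k, hk⟩ := exists_QModMemHK_of_pos (g := g)
      (p := homogConstraint a b fun i => (1 - t) * x i + t * x' i) fun y hy => by
    rw [eval_homogConstraint_convexCombination]
    exact add_pos_of_nonneg_of_pos
      (mul_nonneg (sub_nonneg.2 ht.2.le) (isFeasibleH_iff.1 hx y hy))
      (mul_pos ht.1 (hx' y hy))
  exact (iInf_le _ k).trans (sInf_le ⟨_, hk, rfl⟩)

lemma tendsto_psosHK (h : Condition3 a b g) :
    Filter.Tendsto (psosHK c a b g) Filter.atTop (nhds (ptilde c a b g)) := by
  rw [le_antisymm (le_iInf fun k => ptilde_le_psosHK (c := c) (a := a) (b := b) (g := g) k)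
    (iInf_psosHK_le_ptilde h)]
  exact tendsto_atTop_iInf antitone_psosHK

lemma ptilde_eq {pstar : ℝ}
    (hglb : IsGLB {v : ℝ | ∃ x, isFeasible a b g x ∧ v = ∑ i, c i * x i} pstar)
    (h : ∀ ε : ℝ, 0 < ε → ∃ x, isFeasibleH a b g x ∧ ∑ i, c i * x i ≤ pstar + ε) :
    ptilde c a b g = pstar := by
  apply le_antisymm
  · have hlim : Filter.Tendsto (fun ε : ℝ => ((pstar + ε : ℝ) : EReal))
        (nhdsWithin 0 (Set.Ioi 0)) (nhds (pstar : EReal)) := by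
      refine tendsto_nhdsWithin_of_tendsto_nhds ?_
      have hcont : Continuous fun ε : ℝ => ((pstar + ε : ℝ) : EReal) :=
        continuous_coe_real_ereal.comp (by fun_prop)
      simpa using hcont.tendsto 0
    refine ge_of_tendsto hlim ?_
    filter_upwards [self_mem_nhdsWithin] with ε hε
    obtain ⟨x, hx, hxε⟩ := h ε hε
    exact (ptilde_le hx).trans (EReal.coe_le_coe_iff.2 hxε)
  · refine le_sInf ?_
    rintro _ ⟨x, hx, rfl⟩
    exact EReal.coe_le_coe_iff.2 (hglb.1 ⟨x, isFeasibleH.isFeasible hx, rfl⟩)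

end Values

/-- under Condition 3, the values p̃^sos_k are nonincreasing in k,
bounded below by p̃*, and converge to p̃*; moreover, if S is closed at ∞ or Condition 2
holds, they converge to p*. -/
theorem stmt14 {n m s : ℕ} (c : Fin m → ℝ) (a : Fin m → MvPolynomial (Fin n) ℝ)
    (b : MvPolynomial (Fin n) ℝ) (g : Fin s → MvPolynomial (Fin n) ℝ)
    (pstar : ℝ)
    (hfeas : ∃ x, isFeasible a b g x)
    (hglb : IsGLB {v : ℝ | ∃ x, isFeasible a b g x ∧ v = ∑ i, c i * x i} pstar)
    (hcond3 : Condition3 a b g) :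
    (∀ k₁ k₂ : ℕ, k₁ ≤ k₂ → psosHK c a b g k₂ ≤ psosHK c a b g k₁) ∧
    (∀ k : ℕ, ptilde c a b g ≤ psosHK c a b g k) ∧
    Filter.Tendsto (psosHK c a b g) Filter.atTop (nhds (ptilde c a b g)) ∧
    ((closure (tildeSPos g) = tildeS g ∨ Condition2 c a b g pstar) →
      Filter.Tendsto (psosHK c a b g) Filter.atTop (nhds (pstar : EReal))) := by
  refine ⟨fun _ _ h => antitone_psosHK h, ptilde_le_psosHK, tendsto_psosHK hcond3, fun h => ?_⟩
  rw [← ptilde_eq hglb fun ε hε => ?_]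
  · exact tendsto_psosHK hcond3
  rcases h with hS | h2
  · obtain ⟨_, ⟨x, hx, rfl⟩, -, hlt⟩ := hglb.exists_between (lt_add_of_pos_right pstar hε)
    exact ⟨x, hx.isFeasibleH_of_closure_eq hS, hlt.le⟩
  · obtain ⟨x, hx, hxε, hhat⟩ := h2 ε hε
    exact ⟨x, hx.isFeasibleH_of_hatS hhat, by linarith⟩
end

section
/- The set S = {(y_1, y_2) ∈ ℝ^2 : y_1 ≥ 0, y_1^2 − y_2^3 ≥ 0}, with generators g_1 = Y_1 and g_2 = Y_1^2 − Y_2^3, is closed at ∞: the closure of S̃_> = {(y_0, y_1, y_2) ∈ ℝ^3 : y_1 ≥ 0, y_0 y_1^2 − y_2^3 ≥ 0, y_0 > 0, y_0^2 + y_1^2 + y_2^2 = 1} equals S̃ = {(y_0, y_1, y_2) ∈ ℝ^3 : y_1 ≥ 0, y_0 y_1^2 − y_2^3 ≥ 0, y_0 ≥ 0, y_0^2 + y_1^2 + y_2^2 = 1}. -/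
/-- the set S = {(y₁,y₂) : y₁ ≥ 0, y₁² − y₂³ ≥ 0}, with generators
g₁ = Y₁ (homogenization Y₁) and g₂ = Y₁² − Y₂³ (homogenization Y₀Y₁² − Y₂³), is
closed at ∞: the closure of S̃_> equals S̃. -/
theorem stmt16 :
    closure {y : Fin 3 → ℝ | 0 ≤ y 1 ∧ 0 ≤ y 0 * (y 1) ^ 2 - (y 2) ^ 3 ∧ 0 < y 0 ∧
        (y 0) ^ 2 + (y 1) ^ 2 + (y 2) ^ 2 = 1} =
      {y : Fin 3 → ℝ | 0 ≤ y 1 ∧ 0 ≤ y 0 * (y 1) ^ 2 - (y 2) ^ 3 ∧ 0 ≤ y 0 ∧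
        (y 0) ^ 2 + (y 1) ^ 2 + (y 2) ^ 2 = 1} := by
  apply Set.Subset.antisymm
  · refine closure_minimal (fun y ⟨h₁, h₂, h₀, hn⟩ => ⟨h₁, h₂, h₀.le, hn⟩) ?_
    simp only [Set.ofPred_and]
    refine (isClosed_le ?_ ?_).inter ((isClosed_le ?_ ?_).inter
      ((isClosed_le ?_ ?_).inter (isClosed_eq ?_ ?_))) <;> fun_prop
  · rintro y ⟨h₁, h₂, h₀, hn⟩
    -- Push `y` in the direction of the zeroth coordinate and renormalize.
    let c : ℝ → ℝ := fun t => (√((y 0 + t) ^ 2 + y 1 ^ 2 + y 2 ^ 2))⁻¹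
    let f : ℝ → Fin 3 → ℝ := fun t => c t • ![y 0 + t, y 1, y 2]
    have hc : ContinuousAt c 0 := by
      refine ContinuousAt.inv₀ (by fun_prop) ?_
      simp [hn]
    have hf : ContinuousAt f 0 := by
      refine hc.smul (Continuous.continuousAt ?_)
      fun_prop
    have hf₀ : f 0 = y := by
      ext i
      fin_cases i <;> simp [f, c, hn]
    refine mem_closure_of_tendsto (b := nhdsWithin 0 (Set.Ioi 0)) (f := f)
      (hf₀ ▸ hf.tendsto.mono_left nhdsWithin_le_nhds) ?_
    filter_upwards [self_mem_nhdsWithin] with t (ht : 0 < t)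
    have hpos : 0 < (y 0 + t) ^ 2 + y 1 ^ 2 + y 2 ^ 2 := by positivity
    have hct : 0 < c t := inv_pos.mpr (Real.sqrt_pos.mpr hpos)
    have hsq : c t ^ 2 * ((y 0 + t) ^ 2 + y 1 ^ 2 + y 2 ^ 2) = 1 := by
      simp only [c, inv_pow, Real.sq_sqrt hpos.le]
      exact inv_mul_cancel₀ hpos.ne'
    have hg : 0 ≤ (y 0 + t) * y 1 ^ 2 - y 2 ^ 3 := by
      nlinarith [mul_nonneg ht.le (sq_nonneg (y 1))]
    change 0 ≤ c t * y 1 ∧ 0 ≤ c t * (y 0 + t) * (c t * y 1) ^ 2 - (c t * y 2) ^ 3 ∧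
      0 < c t * (y 0 + t) ∧
      (c t * (y 0 + t)) ^ 2 + (c t * y 1) ^ 2 + (c t * y 2) ^ 2 = 1
    refine ⟨by positivity, ?_, by positivity, by linear_combination hsq⟩
    calc 0 ≤ c t ^ 3 * ((y 0 + t) * y 1 ^ 2 - y 2 ^ 3) := by positivity
      _ = _ := by ring
end
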